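/- Let ν^∞ be the staircase laminate associated to staircase-laminate data (A_n, μ_n, γ_n) for a set K ⊂ ℝ^{d×m} with base A = A_0, and suppose |A_n| ≤ |A_{n+1}| ≤ c|A_n| for all n ≥ 0 and some c > 1; write β_n := γ_1⋯γ_n (β_0 := 1). (Upper bound) If for some 1 ≤ p < ∞ there exist c₀, M₀ ≥ 1 such that supp μ_n ⊂ {X : |X| ≤ c₀|A_n|} and β_n|A_n|^p ≤ M₀ for all n ≥ 0, then ν^∞({X : |X| > t}) ≤ M₀ c^p c₀^p t^{−p} for all t > 0. (Lower bound) If for some 1 ≤ p < ∞ there exist c₁ ∈ (0,1] and M₁ > 0 such that μ_n({X : |X| ≥ c₁|A_n|}) ≥ c₁ and β_n|A_n|^p ≥ M₁ for all n ≥ 0, then ν^∞({X : |X| > t}) ≥ M₁ c^{−p} c₁^{1+p} t^{−p} for all t > c₁|A|. -/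

import Mathlib

open MeasureTheory Set Filter Topology

noncomputable section

namespace Paper

variable {ι κ : Type*}

/-- Frobenius (Hilbert–Schmidt) norm of a matrix. -/
def frobNorm [Fintype ι] [Fintype κ] (A : Matrix κ ι ℝ) : ℝ :=
  Real.sqrt (∑ k, ∑ i, (A k i) ^ 2)

/-- Frobenius distance from a matrix to a set of matrices. -/
def frobDist [Fintype ι] [Fintype κ] (X : Matrix κ ι ℝ) (S : Set (Matrix κ ι ℝ)) : ℝ :=
  sInf ((fun Y => frobNorm (X - Y)) '' S)

/-- The affine map `x ↦ A x + b`. -/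
def lmap [Fintype ι] (A : Matrix κ ι ℝ) (b : κ → ℝ) (x : ι → ℝ) : κ → ℝ :=
  fun k => (∑ i, A k i * x i) + b k

/-- A regular domain: open, bounded, connected, with Lebesgue-null boundary. -/
def IsRegularDomain [Fintype ι] (Ω : Set (ι → ℝ)) : Prop :=
  IsOpen Ω ∧ Bornology.IsBounded Ω ∧ IsConnected Ω ∧ volume (frontier Ω) = 0

/-- `u` agrees with an affine map on `S`. -/
def IsAffineOn [Fintype ι] (u : (ι → ℝ) → κ → ℝ) (S : Set (ι → ℝ)) : Prop :=
  ∃ (B : Matrix κ ι ℝ) (c : κ → ℝ), ∀ x ∈ S, u x = lmap B c x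

/-- `u` is piecewise affine on `Ω`. -/
def IsPiecewiseAffineOn [Fintype ι] (u : (ι → ℝ) → κ → ℝ) (Ω : Set (ι → ℝ)) : Prop :=
  ∃ 𝒮 : Set (Set (ι → ℝ)), 𝒮.Countable ∧
    (∀ V ∈ 𝒮, IsRegularDomain V ∧ V ⊆ Ω ∧ IsAffineOn u V) ∧
    𝒮.PairwiseDisjoint id ∧ volume (Ω \ ⋃₀ 𝒮) = 0

/-- `G` is the weak (distributional) gradient of `u` on `Ω`, and `u ∈ W^{1,1}(Ω)`. -/
structure HasWeakGradientOn [Fintype ι] [DecidableEq ι] [Fintype κ]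
    (u : (ι → ℝ) → κ → ℝ) (G : (ι → ℝ) → Matrix κ ι ℝ) (Ω : Set (ι → ℝ)) : Prop where
  integrable : IntegrableOn u Ω volume
  integrable_grad : ∀ (k : κ) (i : ι), IntegrableOn (fun x => G x k i) Ω volume
  parts : ∀ φ : (ι → ℝ) → ℝ, (∀ n : ℕ, ContDiff ℝ n φ) → HasCompactSupport φ →
    tsupport φ ⊆ Ω → ∀ (k : κ) (i : ι),
      ∫ x in Ω, u x k * fderiv ℝ φ x (Pi.single i 1) = - ∫ x in Ω, G x k i * φ x

/-- Membership in `C^α(S)`: continuous on `S` and (for `α > 0`) `α`-Hölder on `S`. -/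
def MemHolder [Fintype ι] [Fintype κ] (α : ℝ) (S : Set (ι → ℝ)) (u : (ι → ℝ) → κ → ℝ) : Prop :=
  ContinuousOn u S ∧ ∃ C : ℝ, ∀ x ∈ S, ∀ y ∈ S, dist (u x) (u y) ≤ C * dist x y ^ α

/-- The `C^α` norm on `S`. -/
def holderNorm [Fintype ι] [Fintype κ] (α : ℝ) (S : Set (ι → ℝ)) (u : (ι → ℝ) → κ → ℝ) : ℝ :=
  sSup ((fun x => ‖u x‖) '' S) +
    sSup {r : ℝ | ∃ x ∈ S, ∃ y ∈ S, x ≠ y ∧ r = dist (u x) (u y) / dist x y ^ α}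

/-- `K` can be reduced to `K'` in weak `L^p`, with constant `M`. -/
def ReducesWith [Fintype ι] [DecidableEq ι] [Fintype κ] (M : ℝ)
    (K K' : Set (Matrix κ ι ℝ)) (p : ℝ) : Prop :=
  ∀ A ∈ K, ∀ b : κ → ℝ, ∀ ε ∈ Set.Ioo (0:ℝ) 1, ∀ α ∈ Set.Ioo (0:ℝ) 1, ∀ s ∈ Set.Ioi (1:ℝ),
    ∀ Ω : Set (ι → ℝ), IsRegularDomain Ω →
      ∃ (u : (ι → ℝ) → κ → ℝ) (G : (ι → ℝ) → Matrix κ ι ℝ),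
        IsPiecewiseAffineOn u Ω ∧ HasWeakGradientOn u G Ω ∧ MemHolder α (closure Ω) u ∧
        (∀ x ∈ frontier Ω, u x = lmap A b x) ∧
        (∫ x in {x ∈ Ω | G x ∉ K'}, (1 + frobNorm (G x)) ^ s) < ε * (volume Ω).toReal ∧
        ∀ t : ℝ, 0 < t →
          volume {x ∈ Ω | t < frobNorm (G x)}
            ≤ ENNReal.ofReal (M ^ p * (1 + frobNorm A ^ p) * t ^ (-p)) * volume Ω

/-- `K` can be reduced to `K'` in weak `L^p`. -/
def ReducedTo [Fintype ι] [DecidableEq ι] [Fintype κ]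
    (K K' : Set (Matrix κ ι ℝ)) (p : ℝ) : Prop :=
  ∃ M : ℝ, 1 ≤ M ∧ ReducesWith M K K' p

instance : MeasurableSpace (Matrix κ ι ℝ) :=
  inferInstanceAs (MeasurableSpace (κ → ι → ℝ))

/-- Laminates of finite order: the smallest family of (probability) measures on matrix space
containing Dirac masses and closed under elementary splitting. -/
inductive IsLaminate [Fintype ι] [Fintype κ] : Measure (Matrix κ ι ℝ) → Prop
  | dirac (A : Matrix κ ι ℝ) : IsLaminate (Measure.dirac A)
  | split (lam lam' : ℝ) (A B B' : Matrix κ ι ℝ) (ν' : Measure (Matrix κ ι ℝ))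
      (hlam : lam ∈ Set.Ioc (0:ℝ) 1) (hlam' : lam' ∈ Set.Ioo (0:ℝ) 1)
      (hprob : IsProbabilityMeasure ν') (hrank : (B' - B).rank = 1)
      (hA : A = lam' • B + (1 - lam') • B')
      (hν : IsLaminate (ENNReal.ofReal lam • Measure.dirac A + ENNReal.ofReal (1 - lam) • ν')) :
      IsLaminate (ENNReal.ofReal lam •
          (ENNReal.ofReal lam' • Measure.dirac B + ENNReal.ofReal (1 - lam') • Measure.dirac B')
        + ENNReal.ofReal (1 - lam) • ν')

/-- Barycenter (center of mass) of a measure on matrix space, defined entrywise. -/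
def barycenter [Fintype ι] [Fintype κ] (ν : Measure (Matrix κ ι ℝ)) : Matrix κ ι ℝ :=
  Matrix.of fun k i => ∫ X, X k i ∂ν

/-- Staircase-laminate data for `K` with base `A`. -/
structure StaircaseData [Fintype ι] [Fintype κ]
    (K : Set (Matrix κ ι ℝ)) (A : Matrix κ ι ℝ) : Type _ where
  Aseq : ℕ → Matrix κ ι ℝ
  μseq : ℕ → Measure (Matrix κ ι ℝ)
  γseq : ℕ → ℝ
  base : Aseq 0 = A
  notMem : ∀ n, Aseq n ∉ K
  prob : ∀ n, 1 ≤ n → IsProbabilityMeasure (μseq n)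
  suppK : ∀ n, 1 ≤ n → μseq n Kᶜ = 0
  γmem : ∀ n, 1 ≤ n → γseq n ∈ Set.Ioo (0:ℝ) 1
  mono : Monotone fun n => frobNorm (Aseq n)
  norm_tendsto : Tendsto (fun n => frobNorm (Aseq n)) atTop atTop
  beta_tendsto : Tendsto (fun n => ∏ k ∈ Finset.range n, γseq (k + 1)) atTop (nhds 0)
  laminate : ∀ n, 1 ≤ n →
    IsLaminate (ENNReal.ofReal (1 - γseq n) • μseq n
      + ENNReal.ofReal (γseq n) • Measure.dirac (Aseq n))
  bary : ∀ n, 1 ≤ n →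
    barycenter (ENNReal.ofReal (1 - γseq n) • μseq n
      + ENNReal.ofReal (γseq n) • Measure.dirac (Aseq n)) = Aseq (n - 1)

variable [Fintype ι] [Fintype κ]

/-- `β_n = γ_1 ⋯ γ_n`. -/
def beta {K : Set (Matrix κ ι ℝ)} {A : Matrix κ ι ℝ} (D : StaircaseData K A) (n : ℕ) : ℝ :=
  ∏ k ∈ Finset.range n, D.γseq (k + 1)

/-- The finite-stage laminates `ν^N`. -/
def nuN {K : Set (Matrix κ ι ℝ)} {A : Matrix κ ι ℝ} (D : StaircaseData K A) (N : ℕ) :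
    Measure (Matrix κ ι ℝ) :=
  (∑ n ∈ Finset.range N, ENNReal.ofReal (beta D n * (1 - D.γseq (n + 1))) • D.μseq (n + 1))
    + ENNReal.ofReal (beta D N) • Measure.dirac (D.Aseq N)

/-- The associated staircase laminate `ν^∞`. -/
def nuInf {K : Set (Matrix κ ι ℝ)} {A : Matrix κ ι ℝ} (D : StaircaseData K A) :
    Measure (Matrix κ ι ℝ) :=
  Measure.sum fun n => ENNReal.ofReal (beta D n * (1 - D.γseq (n + 1))) • D.μseq (n + 1)


section StaircaseLemmas

variable {K : Set (Matrix κ ι ℝ)} {A : Matrix κ ι ℝ}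

lemma beta_zero (D : StaircaseData K A) : beta D 0 = 1 := by
  simp [beta]

lemma beta_succ (D : StaircaseData K A) (n : ℕ) :
    beta D (n + 1) = beta D n * D.γseq (n + 1) := by
  simp [beta, Finset.prod_range_succ]

lemma beta_pos (D : StaircaseData K A) (n : ℕ) : 0 < beta D n :=
  Finset.prod_pos fun k _ => (D.γmem (k + 1) (by omega)).1

lemma beta_mul_one_sub_nonneg (D : StaircaseData K A) (n : ℕ) :
    0 ≤ beta D n * (1 - D.γseq (n + 1)) :=
  mul_nonneg (beta_pos D n).le (sub_nonneg.2 (D.γmem (n + 1) (by omega)).2.le)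

/-- The total weight of the steps from `n` on telescopes to `β_n`. -/
lemma tsum_beta_mul_one_sub (D : StaircaseData K A) (n : ℕ) :
    ∑' k, ENNReal.ofReal (beta D (k + n) * (1 - D.γseq (k + n + 1))) =
      ENNReal.ofReal (beta D n) := by
  have h : HasSum (fun k => beta D (k + n) * (1 - D.γseq (k + n + 1))) (beta D n) := by
    rw [hasSum_iff_tendsto_nat_of_nonneg fun k => beta_mul_one_sub_nonneg D (k + n)]
    have hsum (N : ℕ) : ∑ k ∈ Finset.range N, beta D (k + n) * (1 - D.γseq (k + n + 1)) =
        beta D n - beta D (N + n) := by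
      induction N with
      | zero => simp
      | succ N ih =>
        rw [Finset.sum_range_succ, ih, show N + 1 + n = N + n + 1 by omega, beta_succ]
        ring
    simp_rw [hsum]
    have hlim : Tendsto (beta D) atTop (𝓝 0) := D.beta_tendsto
    simpa using tendsto_const_nhds.sub (hlim.comp (tendsto_add_atTop_nat n))
  rw [← ENNReal.ofReal_tsum_of_nonneg (fun k => beta_mul_one_sub_nonneg D (k + n)) h.summable,
    h.tsum_eq]

lemma nuInf_apply (D : StaircaseData K A) (S : Set (Matrix κ ι ℝ)) :
    nuInf D S =
      ∑' n, ENNReal.ofReal (beta D n * (1 - D.γseq (n + 1))) * D.μseq (n + 1) S := by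
  simp [nuInf, Measure.sum_apply_of_countable]

/-- If `S` is null for the first `n` measures `μ_k`, then `ν^∞` gives it mass at most `β_n`. -/
lemma nuInf_le_beta (D : StaircaseData K A) (S : Set (Matrix κ ι ℝ)) (n : ℕ)
    (hS : ∀ k < n, D.μseq (k + 1) S = 0) : nuInf D S ≤ ENNReal.ofReal (beta D n) := by
  rw [nuInf_apply, ← ENNReal.summable.sum_add_tsum_nat_add' (k := n),
    Finset.sum_eq_zero fun k hk => by rw [hS k (Finset.mem_range.1 hk), mul_zero], zero_add,
    ← tsum_beta_mul_one_sub D n]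
  refine ENNReal.tsum_le_tsum fun k => mul_le_of_le_one_right' ?_
  have := D.prob (k + n + 1) (by omega)
  exact prob_le_one

/-- If `μ_k S ≥ a` for all `k > n`, then `ν^∞` gives `S` mass at least `β_n * a`. -/
lemma beta_mul_le_nuInf (D : StaircaseData K A) (S : Set (Matrix κ ι ℝ)) (n : ℕ) (a : ENNReal)
    (hS : ∀ k, n ≤ k → a ≤ D.μseq (k + 1) S) : ENNReal.ofReal (beta D n) * a ≤ nuInf D S := by
  rw [nuInf_apply, ← ENNReal.summable.sum_add_tsum_nat_add' (k := n),
    ← tsum_beta_mul_one_sub D n, ← ENNReal.tsum_mul_right]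
  refine le_add_left (ENNReal.tsum_le_tsum fun k => ?_)
  gcongr
  exact hS (k + n) (by omega)

/-- The first step at which the norms `|A_n|`, `n ≥ 1`, exceed a given level. -/
lemma exists_first_exceed (D : StaircaseData K A) (s : ℝ) :
    ∃ n, s < frobNorm (D.Aseq (n + 1)) ∧ ∀ k < n, frobNorm (D.Aseq (k + 1)) ≤ s := by
  have h : ∃ n, s < frobNorm (D.Aseq (n + 1)) :=
    ((D.norm_tendsto.comp (tendsto_add_atTop_nat 1)).eventually_gt_atTop s).exists
  classical
  exact ⟨Nat.find h, Nat.find_spec h, fun k hk => not_lt.1 (Nat.find_min h hk)⟩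

lemma frobNorm_Aseq_pos (D : StaircaseData K A) {c : ℝ} (hc : 0 < c)
    (hgrowth : ∀ n : ℕ, frobNorm (D.Aseq (n + 1)) ≤ c * frobNorm (D.Aseq n)) (n : ℕ) :
    0 < frobNorm (D.Aseq n) := by
  by_contra! h
  obtain ⟨m, hm, hnm⟩ :=
    ((D.norm_tendsto.eventually_gt_atTop 0).and (eventually_ge_atTop n)).exists
  have hle : ∀ k, frobNorm (D.Aseq (n + k)) ≤ 0 := fun k => by
    induction k with
    | zero => exact h
    | succ k ih => exact (hgrowth (n + k)).trans (mul_nonpos_of_nonneg_of_nonpos hc.le ih)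
  obtain ⟨k, rfl⟩ := Nat.exists_eq_add_of_le hnm
  exact (hle k).not_gt hm

end StaircaseLemmas

/-- Lemma (weak `L^p` bounds for staircase laminates): upper and lower bounds. -/
theorem staircase_weak_Lp_bounds {d m : ℕ}
    (K : Set (Matrix (Fin d) (Fin m) ℝ)) (A : Matrix (Fin d) (Fin m) ℝ)
    (D : StaircaseData K A) (c : ℝ) (hc : 1 < c)
    (hgrowth : ∀ n : ℕ, frobNorm (D.Aseq (n + 1)) ≤ c * frobNorm (D.Aseq n)) :
    -- Upper bound
    (∀ p : ℝ, 1 ≤ p → ∀ c₀ M₀ : ℝ, 1 ≤ c₀ → 1 ≤ M₀ →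
      (∀ n : ℕ, D.μseq n {X | c₀ * frobNorm (D.Aseq n) < frobNorm X} = 0) →
      (∀ n : ℕ, beta D n * frobNorm (D.Aseq n) ^ p ≤ M₀) →
      ∀ t : ℝ, 0 < t →
        nuInf D {X | t < frobNorm X} ≤ ENNReal.ofReal (M₀ * c ^ p * c₀ ^ p * t ^ (-p))) ∧
    -- Lower bound
    (∀ p : ℝ, 1 ≤ p → ∀ c₁ M₁ : ℝ, c₁ ∈ Set.Ioc (0:ℝ) 1 → 0 < M₁ →
      (∀ n : ℕ, ENNReal.ofReal c₁ ≤ D.μseq n {X | c₁ * frobNorm (D.Aseq n) ≤ frobNorm X}) →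
      (∀ n : ℕ, M₁ ≤ beta D n * frobNorm (D.Aseq n) ^ p) →
      ∀ t : ℝ, c₁ * frobNorm A < t →
        ENNReal.ofReal (M₁ * c ^ (-p) * c₁ ^ (1 + p) * t ^ (-p)) ≤ nuInf D {X | t < frobNorm X}) := by
  have hc0 : 0 < c := by linarith
  have hpos := frobNorm_Aseq_pos D hc0 hgrowth
  constructor
  · intro p hp c₀ M₀ hc₀ hM₀ hsupp hbound t ht
    have hc₀' : 0 < c₀ := by linarith
    obtain ⟨n, hn, hmin⟩ := exists_first_exceed D (t / c₀)
    refine (nuInf_le_beta D _ n fun k hk => ?_).trans (ENNReal.ofReal_le_ofReal ?_)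
    · refine measure_mono_null (fun X hX => ?_) (hsupp (k + 1))
      have := (le_div_iff₀ hc₀').1 (hmin k hk)
      exact lt_of_le_of_lt (by linarith) (show t < frobNorm X from hX)
    · have hlow : t ≤ c * c₀ * frobNorm (D.Aseq n) := by
        have := (div_lt_iff₀ hc₀').1 (hn.trans_le (hgrowth n))
        linarith
      have hpow : t ^ p ≤ c ^ p * c₀ ^ p * frobNorm (D.Aseq n) ^ p := by
        rw [← Real.mul_rpow hc0.le hc₀'.le, ← Real.mul_rpow (by positivity) (hpos n).le]
        exact Real.rpow_le_rpow ht.le hlow (by linarith)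
      rw [Real.rpow_neg ht.le, ← div_eq_mul_inv, le_div_iff₀ (Real.rpow_pos_of_pos ht p)]
      calc beta D n * t ^ p
          ≤ beta D n * (c ^ p * c₀ ^ p * frobNorm (D.Aseq n) ^ p) :=
            mul_le_mul_of_nonneg_left hpow (beta_pos D n).le
        _ = beta D n * frobNorm (D.Aseq n) ^ p * (c ^ p * c₀ ^ p) := by ring
        _ ≤ M₀ * (c ^ p * c₀ ^ p) := mul_le_mul_of_nonneg_right (hbound n) (by positivity)
        _ = M₀ * c ^ p * c₀ ^ p := by ring
  · intro p hp c₁ M₁ hc₁ hM₁ hmass hbound t ht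
    have hc₁' : 0 < c₁ := hc₁.1
    have ht0 : 0 < t := by
      have := mul_pos hc₁' (hpos 0)
      rw [D.base] at this
      linarith
    obtain ⟨n, hn, hmin⟩ := exists_first_exceed D (t / c₁)
    have hup : c₁ * frobNorm (D.Aseq n) ≤ t := by
      cases n with
      | zero => rw [D.base]; exact ht.le
      | succ k =>
        rw [mul_comm]
        exact (le_div_iff₀ hc₁').1 (hmin k (by omega))
    refine le_trans ?_ (beta_mul_le_nuInf D _ n (ENNReal.ofReal c₁) fun k hk =>
      (hmass (k + 1)).trans (measure_mono fun X hX => ?_))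
    · rw [← ENNReal.ofReal_mul (beta_pos D n).le]
      refine ENNReal.ofReal_le_ofReal ?_
      have hpow : c₁ ^ p * frobNorm (D.Aseq n) ^ p ≤ t ^ p := by
        rw [← Real.mul_rpow hc₁'.le (hpos n).le]
        exact Real.rpow_le_rpow (mul_pos hc₁' (hpos n)).le hup (by linarith)
      have hcp : c ^ (-p) ≤ 1 := Real.rpow_le_one_of_one_le_of_nonpos hc.le (by linarith)
      rw [Real.rpow_neg ht0.le, ← div_eq_mul_inv, div_le_iff₀ (Real.rpow_pos_of_pos ht0 p),
        Real.rpow_add hc₁', Real.rpow_one]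
      calc M₁ * c ^ (-p) * (c₁ * c₁ ^ p)
          ≤ M₁ * 1 * (c₁ * c₁ ^ p) := by gcongr
        _ = M₁ * (c₁ * c₁ ^ p) := by ring
        _ ≤ beta D n * frobNorm (D.Aseq n) ^ p * (c₁ * c₁ ^ p) :=
            mul_le_mul_of_nonneg_right (hbound n) (by positivity)
        _ = beta D n * c₁ * (c₁ ^ p * frobNorm (D.Aseq n) ^ p) := by ring
        _ ≤ beta D n * c₁ * t ^ p :=
            mul_le_mul_of_nonneg_left hpow (mul_pos (beta_pos D n) hc₁').le
    · have h1 := (div_lt_iff₀ hc₁').1 (hn.trans_le (D.mono (Nat.succ_le_succ hk)))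
      have h2 : c₁ * frobNorm (D.Aseq (k + 1)) ≤ frobNorm X := hX
      have h3 : frobNorm (D.Aseq (k + 1)) * c₁ = c₁ * frobNorm (D.Aseq (k + 1)) := mul_comm _ _
      exact (h3 ▸ h1).trans_le h2

end Paper
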